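/- Let ε > 0 and let γ, g : ℝ^d → ℂ be (d+2)-times continuously differentiable functions such that for all α, β ∈ {0,1}^d and all j = 1,…,d the functions x^β ∂^α γ, x^β ∂_{x_j} ∂^α γ, x_j x^β ∂^α γ and x^β ∂^α g, x^β ∂_{x_j} ∂^α g, x_j x^β ∂^α g all have finite L^∞_ε-norm. Then for every (x,ω) ∈ ℝ^{2d} and every k = 1,…,d, (1+|x|)^{d+ε} (1+|ω_k|)² ∏_{j≠k} (1+|ω_j|) |V_gγ(x,ω)| ≤ 2^{2d+1} d^d (1+1/π)^{d+1} 𝒦^ε_γ 𝒦^ε_g, where 𝒦^ε_γ := max over α,β ∈ {0,1}^d and 1 ≤ j ≤ d of { ‖x^β ∂^α γ‖_{L^∞_ε}, ‖x^β ∂_{x_j} ∂^α γ‖_{L^∞_ε}, ‖x_j x^β ∂^α γ‖_{L^∞_ε} }, and 𝒦^ε_g is defined analogously with g in place of γ. -/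

import Mathlib

open MeasureTheory Matrix Filter
open scoped ENNReal NNReal

noncomputable section

/-- `ℝ^d` with the Euclidean norm. -/
abbrev Euc (d : ℕ) := EuclideanSpace ℝ (Fin d)

/-- `e^{2πit}`. -/
def e2 (t : ℝ) : ℂ := Complex.exp (2 * Real.pi * Complex.I * t)

/-- The dot product `x·ω = ∑ⱼ xⱼωⱼ`. -/
def dotE {d : ℕ} (x y : Euc d) : ℝ := ∑ j, x j * y j

/-- The short-time Fourier transform
`V_gγ(x,ω) = ∫ γ(t) e^{-2πi ω·t} conj(g(t-x)) dt`. -/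
def STFT {d : ℕ} (g γ : Euc d → ℂ) (x ω : Euc d) : ℂ :=
  ∫ t : Euc d, γ t * e2 (-(dotE ω t)) * (starRingEnd ℂ) (g (t - x))

/-- The weighted sup-norm `‖f‖_{L^∞_ε} = ‖(1+|·|)^{d+ε} f‖_{L^∞}` (as an `ℝ≥0∞`). -/
def LinfNorm {d : ℕ} (ε : ℝ) (f : Euc d → ℂ) : ℝ≥0∞ :=
  eLpNorm (fun x : Euc d => ((1 + ‖x‖) ^ ((d : ℝ) + ε) : ℝ) • f x) ⊤ volume

/-- The monomial `x^α = ∏ⱼ x_j^{α_j}` for `α ∈ {0,1}^d`. -/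
def monom {d : ℕ} (α : Fin d → Bool) (x : Euc d) : ℝ :=
  ∏ j, if α j then x j else 1

/-- The partial derivative `∂_{x_j} f`. -/
def pd {d : ℕ} (j : Fin d) (f : Euc d → ℂ) : Euc d → ℂ :=
  fun x => fderiv ℝ f x (EuclideanSpace.single j (1 : ℝ))

/-- The mixed partial derivative `∂^α f` for `α ∈ {0,1}^d`. -/
def pdMulti {d : ℕ} (α : Fin d → Bool) (f : Euc d → ℂ) : Euc d → ℂ :=
  ((List.finRange d).filter fun j => α j).foldr pd f

/-- The constant
`𝒦^ε_f = max_{α,β ∈ {0,1}^d, 1≤j≤d} {‖x^β ∂^α f‖_{L^∞_ε}, ‖x^β ∂_{x_j}∂^α f‖_{L^∞_ε},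
‖x_j x^β ∂^α f‖_{L^∞_ε}}`. -/
def Kconst {d : ℕ} (ε : ℝ) (f : Euc d → ℂ) : ℝ≥0∞ :=
  ⨆ (α : Fin d → Bool) (β : Fin d → Bool) (j : Fin d),
    (LinfNorm ε (fun x => monom β x • pdMulti α f x)
      ⊔ LinfNorm ε (fun x => monom β x • pd j (pdMulti α f) x)
      ⊔ LinfNorm ε (fun x => (x j * monom β x) • pdMulti α f x))

/-- Almost everywhere weighted bound. -/
def Bnd {d : ℕ} (ε K : ℝ) (F : Euc d → ℂ) : Prop :=
  ∀ᵐ t : Euc d, (1 + ‖t‖) ^ ((d : ℝ) + ε) * (∏ j, max 1 |t j|) * ‖F t‖ ≤ K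

/-- All iterated derivatives along sublists are bounded. -/
def Good {d : ℕ} (ε K : ℝ) : List (Fin d) → (Euc d → ℂ) → Prop
  | [], F => Continuous F ∧ Bnd ε K F
  | j :: L, F => ContDiff ℝ 1 F ∧ Good ε K L F ∧ Good ε K L (pd j F)

theorem Good.base {d : ℕ} {ε K : ℝ} {L : List (Fin d)} {F : Euc d → ℂ} (h : Good ε K L F) :
    Continuous F ∧ Bnd ε K F := by
  induction L generalizing F with
  | nil => exact h
  | cons j L ih => exact ih h.2.1

theorem contDiff_pd {d : ℕ} {n : ℕ} {F : Euc d → ℂ} (j : Fin d)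
    (h : ContDiff ℝ (n + 1 : ℕ) F) : ContDiff ℝ n (pd j F) := by
  unfold pd
  have h1 : ContDiff ℝ n (fderiv ℝ F) := h.fderiv_right (by norm_cast)
  exact h1.clm_apply contDiff_const

theorem good_of_sublists {d : ℕ} {ε K : ℝ} (L : List (Fin d)) (F : Euc d → ℂ)
    (hF : ContDiff ℝ L.length F)
    (h : ∀ S : List (Fin d), S.Sublist L → Bnd ε K (S.foldl (fun f j => pd j f) F)) :
    Good ε K L F := by
  induction L generalizing F with
  | nil => exact ⟨hF.continuous, h [] (List.Sublist.refl _)⟩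
  | cons j L ih =>
    refine ⟨hF.of_le ?_, ih F (hF.of_le ?_) fun S hS => h S (hS.cons j),
      ih _ (contDiff_pd j hF) fun S hS => h (j :: S) (hS.cons_cons j)⟩
    · simp only [List.length_cons]; norm_cast; omega
    · simp only [List.length_cons]; norm_cast; omega

theorem sublist_eq_filter {α : Type*} [DecidableEq α] {S L : List α} (h : S.Sublist L)
    (hL : L.Nodup) : L.filter (fun j => decide (j ∈ S)) = S := by
  induction h with
  | slnil => rfl
  | @cons S L a h ih =>
    rw [List.nodup_cons] at hL
    rw [List.filter_cons_of_neg, ih hL.2]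
    simpa using fun ha => hL.1 (h.subset ha)
  | @cons_cons S L a h ih =>
    rw [List.nodup_cons] at hL
    rw [List.filter_cons_of_pos (by simp)]
    congr 1
    conv_rhs => rw [← ih hL.2]
    apply List.filter_congr
    intro x hx
    have : x ≠ a := fun e => hL.1 (e ▸ hx)
    simp [this]

theorem hasFDerivAt_e2 {d : ℕ} (ω t : Euc d) (j : Fin d) :
    Differentiable ℝ (fun t : Euc d => e2 (-(dotE ω t))) ∧
    fderiv ℝ (fun t : Euc d => e2 (-(dotE ω t))) t (EuclideanSpace.single j (1 : ℝ))
      = -(2 * Real.pi * Complex.I * ω j) * e2 (-(dotE ω t)) := by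
  let l : Euc d →L[ℝ] ℝ := ∑ i, ω i • (EuclideanSpace.proj i : Euc d →L[ℝ] ℝ)
  have hl : ∀ t, dotE ω t = l t := by
    intro t
    simp [l, dotE]
  have hlj : l (EuclideanSpace.single j (1 : ℝ)) = ω j := by
    rw [← hl]
    simp [dotE]
  have hd : ∀ t, HasFDerivAt (fun t : Euc d => e2 (-(dotE ω t)))
      (Complex.exp (2 * Real.pi * Complex.I * ((-(dotE ω t) : ℝ) : ℂ)) •
        ((2 * Real.pi * Complex.I : ℂ) • (Complex.ofRealCLM.comp (-l)))) t := by
    intro t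
    unfold e2
    apply HasFDerivAt.cexp
    apply HasFDerivAt.const_mul
    have := (Complex.ofRealCLM.comp (-l)).hasFDerivAt (x := t)
    have hfun : (fun y => ((-(dotE ω y) : ℝ) : ℂ)) = ⇑(Complex.ofRealCLM.comp (-l)) := by
      ext y
      simp [hl]
    rw [hfun]
    exact this
  refine ⟨fun t => (hd t).differentiableAt, ?_⟩
  rw [(hd t).fderiv]
  simp [hlj, e2]
  ring

theorem norm_e2 (t : ℝ) : ‖e2 t‖ = 1 := by
  unfold e2
  rw [show (2 * Real.pi * Complex.I * t : ℂ) = ((2 * Real.pi * t : ℝ) : ℂ) * Complex.I by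
    push_cast; ring]
  exact Complex.norm_exp_ofReal_mul_I _

/-- The product majorant. -/
def maj {d : ℕ} (x t : Euc d) : ℝ := ∏ j, ((1 + (t j) ^ 2)⁻¹ + (1 + (t j - x j) ^ 2)⁻¹)

theorem integral_maj {d : ℕ} (x : Euc d) :
    Integrable (maj x) ∧ ∫ t, maj x t = (2 * Real.pi) ^ d := by
  let f : Fin d → ℝ → ℝ := fun j s => (1 + s ^ 2)⁻¹ + (1 + (s - x j) ^ 2)⁻¹
  have hf2 : ∀ j, Integrable (fun s : ℝ => (1 + (s - x j) ^ 2)⁻¹) := fun j =>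
    integrable_inv_one_add_sq.comp_sub_right (x j)
  have hf : ∀ j, Integrable (f j) := fun j => integrable_inv_one_add_sq.add (hf2 j)
  have hi : ∀ j, ∫ s, f j s = 2 * Real.pi := by
    intro j
    have h2 : ∫ s : ℝ, (1 + (s - x j) ^ 2)⁻¹ = Real.pi := by
      rw [integral_sub_right_eq_self (fun s : ℝ => (1 + s ^ 2)⁻¹) (x j)]
      exact integral_univ_inv_one_add_sq
    show ∫ s, ((1 + s ^ 2)⁻¹ + (1 + (s - x j) ^ 2)⁻¹) = _
    rw [integral_add integrable_inv_one_add_sq (hf2 j), h2, integral_univ_inv_one_add_sq]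
    ring
  have hmp := PiLp.volume_preserving_ofLp (Fin d)
  have he : MeasurableEmbedding (@WithLp.ofLp 2 (Fin d → ℝ)) :=
    (MeasurableEquiv.toLp 2 (Fin d → ℝ)).symm.measurableEmbedding
  have hm : maj x = (fun s : Fin d → ℝ => ∏ j, f j (s j)) ∘ (@WithLp.ofLp 2 (Fin d → ℝ)) := rfl
  constructor
  · rw [hm, hmp.integrable_comp_emb he]
    exact Integrable.fintype_prod hf
  · rw [hm]
    have := hmp.integral_comp he (fun s : Fin d → ℝ => ∏ j, f j (s j))
    refine this.trans ?_
    rw [integral_fintype_prod_volume_eq_prod]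
    simp [hi]

theorem max_prod_bound (a b : ℝ) :
    1 ≤ max 1 |a| * max 1 |b| * ((1 + a ^ 2)⁻¹ + (1 + b ^ 2)⁻¹) := by
  set A := max 1 |a| with hA
  set B := max 1 |b| with hB
  have hA1 : 1 ≤ A := le_max_left _ _
  have hB1 : 1 ≤ B := le_max_left _ _
  have ha : 1 + a ^ 2 ≤ 2 * A ^ 2 := by
    have : |a| ≤ A := le_max_right _ _
    have : a ^ 2 ≤ A ^ 2 := by rw [← sq_abs a]; gcongr
    nlinarith
  have hb : 1 + b ^ 2 ≤ 2 * B ^ 2 := by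
    have : |b| ≤ B := le_max_right _ _
    have : b ^ 2 ≤ B ^ 2 := by rw [← sq_abs b]; gcongr
    nlinarith
  have h1 : (2 * A ^ 2)⁻¹ ≤ (1 + a ^ 2)⁻¹ := by gcongr
  have h2 : (2 * B ^ 2)⁻¹ ≤ (1 + b ^ 2)⁻¹ := by gcongr
  have h3 : 1 ≤ A * B * ((2 * A ^ 2)⁻¹ + (2 * B ^ 2)⁻¹) := by
    have : A * B * ((2 * A ^ 2)⁻¹ + (2 * B ^ 2)⁻¹) = (A ^ 2 + B ^ 2) / (2 * A * B) := by
      field_simp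
      ring
    rw [this, le_div_iff₀ (by positivity)]
    nlinarith [sq_nonneg (A - B)]
  refine h3.trans ?_
  gcongr

theorem ptwise {d : ℕ} {ε K1 K2 : ℝ} (hε : 0 < ε) (hK1 : 0 ≤ K1) {F G : Euc d → ℂ}
    (hF : Bnd ε K1 F) (hG : Bnd ε K2 G) (x : Euc d) :
    ∀ᵐ t : Euc d, (1 + ‖x‖) ^ ((d : ℝ) + ε) * (‖F t‖ * ‖G (t - x)‖) ≤ K1 * K2 * maj x t := by
  have hG' : ∀ᵐ t : Euc d, (1 + ‖t - x‖) ^ ((d : ℝ) + ε) * (∏ j, max 1 |t j - x j|)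
      * ‖G (t - x)‖ ≤ K2 :=
    (measurePreserving_sub_right volume x).quasiMeasurePreserving.ae hG
  filter_upwards [hF, hG'] with t h1 h2
  set p := (d : ℝ) + ε with hp
  have hp0 : 0 ≤ p := by positivity
  have hx : (1 + ‖x‖) ^ p ≤ (1 + ‖t‖) ^ p * (1 + ‖t - x‖) ^ p := by
    rw [← Real.mul_rpow (by positivity) (by positivity)]
    apply Real.rpow_le_rpow (by positivity) _ hp0
    have : ‖x‖ ≤ ‖t‖ + ‖t - x‖ := by
      have := norm_sub_le t (t - x)
      simpa using this
    nlinarith [norm_nonneg t, norm_nonneg (t - x), mul_nonneg (norm_nonneg t) (norm_nonneg (t - x))]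
  set P := ∏ j, max 1 |t j| with hP
  set Q := ∏ j, max 1 |t j - x j| with hQ
  have hm0 : 0 ≤ maj x t := by unfold maj; positivity
  have hP0 : 0 ≤ P := Finset.prod_nonneg fun j _ => by positivity
  have hQ0 : 0 ≤ Q := Finset.prod_nonneg fun j _ => by positivity
  have hPQ : 1 ≤ P * Q * maj x t := by
    rw [hP, hQ, maj, ← Finset.prod_mul_distrib, ← Finset.prod_mul_distrib]
    have := Finset.prod_le_prod (s := Finset.univ) (f := fun _ : Fin d => (1 : ℝ))
      (fun _ _ => zero_le_one) (fun j _ => max_prod_bound (t j) (t j - x j))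
    simpa using this
  have h12 := mul_le_mul h1 h2 (by positivity) hK1
  calc (1 + ‖x‖) ^ p * (‖F t‖ * ‖G (t - x)‖)
      ≤ ((1 + ‖t‖) ^ p * (1 + ‖t - x‖) ^ p) * (‖F t‖ * ‖G (t - x)‖) * 1 := by
        rw [mul_one]; gcongr
    _ ≤ ((1 + ‖t‖) ^ p * (1 + ‖t - x‖) ^ p) * (‖F t‖ * ‖G (t - x)‖) * (P * Q * maj x t) := by
        gcongr
    _ = ((1 + ‖t‖) ^ p * P * ‖F t‖) * ((1 + ‖t - x‖) ^ p * Q * ‖G (t - x)‖) * maj x t := by ring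
    _ ≤ K1 * K2 * maj x t := by gcongr

theorem base_est {d : ℕ} {ε K1 K2 : ℝ} (hε : 0 < ε) (hK1 : 0 ≤ K1) {F G : Euc d → ℂ}
    (hFc : Continuous F) (hGc : Continuous G)
    (hF : Bnd ε K1 F) (hG : Bnd ε K2 G) (x ω : Euc d) :
    Integrable (fun t => F t * (starRingEnd ℂ) (G (t - x))) ∧
    ‖STFT G F x ω‖ ≤ ((1 + ‖x‖) ^ ((d : ℝ) + ε))⁻¹ * (K1 * K2 * (2 * Real.pi) ^ d) := by
  have hw : 0 < (1 + ‖x‖) ^ ((d : ℝ) + ε) := by positivity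
  obtain ⟨hmi, hme⟩ := integral_maj x
  have hb : ∀ᵐ t : Euc d, ‖F t‖ * ‖G (t - x)‖
      ≤ ((1 + ‖x‖) ^ ((d : ℝ) + ε))⁻¹ * (K1 * K2 * maj x t) := by
    filter_upwards [ptwise hε hK1 hF hG x] with t ht
    rwa [le_inv_mul_iff₀ hw]
  have hint : Integrable (fun t => ((1 + ‖x‖) ^ ((d : ℝ) + ε))⁻¹ * (K1 * K2 * maj x t)) :=
    (hmi.const_mul _).const_mul _
  constructor
  · refine hint.mono' (by fun_prop) ?_
    filter_upwards [hb] with t ht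
    simpa using ht
  · have := norm_integral_le_of_norm_le hint
      (f := fun t => F t * e2 (-(dotE ω t)) * (starRingEnd ℂ) (G (t - x))) (by
        filter_upwards [hb] with t ht
        simpa [norm_e2] using ht)
    rwa [integral_const_mul, integral_const_mul, hme] at this

theorem step {d : ℕ} {F G : Euc d → ℂ} (x ω : Euc d) (j : Fin d)
    (hF : ContDiff ℝ 1 F) (hG : ContDiff ℝ 1 G)
    (h0 : Integrable (fun t => F t * (starRingEnd ℂ) (G (t - x))))
    (h1 : Integrable (fun t => pd j F t * (starRingEnd ℂ) (G (t - x))))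
    (h2 : Integrable (fun t => F t * (starRingEnd ℂ) (pd j G (t - x)))) :
    (2 * Real.pi) * |ω j| * ‖STFT G F x ω‖ ≤ ‖STFT G (pd j F) x ω‖ + ‖STFT (pd j G) F x ω‖ := by
  set v : Euc d := EuclideanSpace.single j (1 : ℝ) with hv
  set E : Euc d → ℂ := fun t => e2 (-(dotE ω t)) with hE
  have hEd : Differentiable ℝ E := (hasFDerivAt_e2 ω 0 j).1
  have hE' : ∀ t, fderiv ℝ E t v = -(2 * Real.pi * Complex.I * ω j) * E t :=
    fun t => (hasFDerivAt_e2 ω t j).2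
  have hEn : ∀ t, ‖E t‖ ≤ 1 := fun t => (norm_e2 _).le
  set H : Euc d → ℂ := fun t => F t * (starRingEnd ℂ) (G (t - x)) with hH
  have hFd : Differentiable ℝ F := hF.differentiable (by norm_num)
  have hGd : Differentiable ℝ G := hG.differentiable (by norm_num)
  have hHd : ∀ t, HasFDerivAt H (F t • (Complex.conjCLE.toContinuousLinearMap.comp
      (fderiv ℝ G (t - x))) + (starRingEnd ℂ) (G (t - x)) • fderiv ℝ F t) t := by
    intro t
    have hg : HasFDerivAt (fun t => (starRingEnd ℂ) (G (t - x)))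
        (Complex.conjCLE.toContinuousLinearMap.comp (fderiv ℝ G (t - x))) t := by
      have a : HasFDerivAt (fun t => G (t - x)) (fderiv ℝ G (t - x)) t :=
        (hasFDerivAt_comp_sub x).2 (hGd (t - x)).hasFDerivAt
      exact (Complex.conjCLE.toContinuousLinearMap.hasFDerivAt).comp t a
    exact (hFd t).hasFDerivAt.mul hg
  have hH' : ∀ t, fderiv ℝ H t v = pd j F t * (starRingEnd ℂ) (G (t - x))
      + F t * (starRingEnd ℂ) (pd j G (t - x)) := by
    intro t
    rw [(hHd t).fderiv]
    simp [pd, ← hv]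
    ring
  have hEm : ∀ {f : Euc d → ℂ}, Integrable f → Integrable (fun t => f t * E t) := by
    intro f hf
    exact hf.mul_bdd (c := 1) hEd.continuous.aestronglyMeasurable (Eventually.of_forall hEn)
  have key := integral_mul_fderiv_eq_neg_fderiv_mul_of_integrable (μ := volume) (f := H) (g := E)
    (v := v) (by
      simp only [hH']
      exact hEm (h1.add h2))
    (by
      simp only [hE']
      have := (hEm h0).const_mul (-(2 * Real.pi * Complex.I * ω j))
      refine this.congr (Eventually.of_forall fun t => ?_)
      simp only [hH]; ring)
    (hEm h0) (fun t _ => (hHd t).differentiableAt) (fun t _ => hEd t)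
  have k1 : ∫ t, H t * fderiv ℝ E t v = -(2 * Real.pi * Complex.I * ω j) * STFT G F x ω := by
    unfold STFT
    rw [← integral_const_mul]
    congr 1; ext t
    rw [hE']; simp only [hH, hE]; ring
  have k2 : ∫ t, fderiv ℝ H t v * E t = STFT G (pd j F) x ω + STFT (pd j G) F x ω := by
    unfold STFT
    rw [← integral_add]
    · congr 1; ext t
      rw [hH']; simp only [hE]; ring
    · refine (hEm h1).congr (Eventually.of_forall fun t => ?_)
      simp only [hE]; ring
    · refine (hEm h2).congr (Eventually.of_forall fun t => ?_)
      simp only [hE]; ring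
  rw [k1, k2, neg_mul, neg_inj] at key
  have := norm_add_le (STFT G (pd j F) x ω) (STFT (pd j G) F x ω)
  rw [← key] at this
  simpa [abs_of_pos Real.pi_pos] using this

theorem main_ind {d : ℕ} {ε K1 K2 : ℝ} (hε : 0 < ε) (hK1 : 0 ≤ K1) (x ω : Euc d)
    (L : List (Fin d)) (F G : Euc d → ℂ) (hF : Good ε K1 L F) (hG : Good ε K2 L G) :
    (L.map fun j => 1 + |ω j|).prod * ‖STFT G F x ω‖ ≤ (1 + 1 / Real.pi) ^ L.length *
      (((1 + ‖x‖) ^ ((d : ℝ) + ε))⁻¹ * (K1 * K2 * (2 * Real.pi) ^ d)) := by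
  induction L generalizing F G with
  | nil =>
    simpa using (base_est hε hK1 hF.1 hG.1 hF.2 hG.2 x ω).2
  | cons j L ih =>
    obtain ⟨cF, gF, gF'⟩ := hF
    obtain ⟨cG, gG, gG'⟩ := hG
    have i0 := ih F G gF gG
    have i1 := ih _ G gF' gG
    have i2 := ih F _ gF gG'
    have hs := step x ω j cF cG
      (base_est hε hK1 gF.base.1 gG.base.1 gF.base.2 gG.base.2 x ω).1
      (base_est hε hK1 gF'.base.1 gG.base.1 gF'.base.2 gG.base.2 x ω).1
      (base_est hε hK1 gF.base.1 gG'.base.1 gF.base.2 gG'.base.2 x ω).1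
    have hp0 : 0 ≤ (L.map fun j => 1 + |ω j|).prod := by
      apply List.prod_nonneg
      intro a ha
      obtain ⟨b, -, rfl⟩ := List.mem_map.1 ha
      positivity
    simp only [List.map_cons, List.prod_cons, List.length_cons]
    set p := (L.map fun j => 1 + |ω j|).prod
    set C := ((1 + ‖x‖) ^ ((d : ℝ) + ε))⁻¹ * (K1 * K2 * (2 * Real.pi) ^ d)
    have hpi := Real.pi_pos
    have hs' : |ω j| * ‖STFT G F x ω‖ ≤
        (1 / (2 * Real.pi)) * (‖STFT G (pd j F) x ω‖ + ‖STFT (pd j G) F x ω‖) := by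
      rw [one_div, le_inv_mul_iff₀ (by positivity)]
      linarith
    calc (1 + |ω j|) * p * ‖STFT G F x ω‖
        = p * ‖STFT G F x ω‖ + p * (|ω j| * ‖STFT G F x ω‖) := by ring
      _ ≤ p * ‖STFT G F x ω‖ + p * ((1 / (2 * Real.pi)) *
          (‖STFT G (pd j F) x ω‖ + ‖STFT (pd j G) F x ω‖)) := by gcongr
      _ = p * ‖STFT G F x ω‖ + (1 / (2 * Real.pi)) *
          (p * ‖STFT G (pd j F) x ω‖ + p * ‖STFT (pd j G) F x ω‖) := by ring
      _ ≤ (1 + 1 / Real.pi) ^ L.length * C + (1 / (2 * Real.pi)) *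
          ((1 + 1 / Real.pi) ^ L.length * C + (1 + 1 / Real.pi) ^ L.length * C) := by gcongr
      _ = (1 + 1 / Real.pi) ^ (L.length + 1) * C := by
        rw [pow_succ]
        generalize (1 + 1 / Real.pi) ^ L.length = q
        field_simp
        ring

theorem bnd_of_linf {d : ℕ} {ε : ℝ} {K : ℝ≥0∞} (hK : K ≠ ⊤) {F : Euc d → ℂ}
    (h : ∀ β, LinfNorm ε (fun x => monom β x • F x) ≤ K) : Bnd ε K.toReal F := by
  have h1 : ∀ β : Fin d → Bool, ∀ᵐ t : Euc d,
      ‖((1 + ‖t‖) ^ ((d : ℝ) + ε) : ℝ) • (monom β t • F t)‖ ≤ K.toReal := by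
    intro β
    have h2 := h β
    unfold LinfNorm at h2
    rw [eLpNorm_exponent_top] at h2
    filter_upwards [ae_le_eLpNormEssSup (μ := (volume : Measure (Euc d)))
      (f := fun t : Euc d => ((1 + ‖t‖) ^ ((d : ℝ) + ε) : ℝ) • (monom β t • F t))] with t ht
    have := ENNReal.toReal_mono hK (ht.trans h2)
    simpa using this
  filter_upwards [ae_all_iff.2 h1] with t ht
  have := ht (fun j => decide (1 < |t j|))
  have hm : |monom (fun j => decide (1 < |t j|)) t| = ∏ j, max 1 |t j| := by
    rw [monom, Finset.abs_prod]
    refine Finset.prod_congr rfl fun j _ => ?_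
    by_cases hj : 1 < |t j|
    · simp [hj, max_eq_right hj.le]
    · simp [hj, max_eq_left (not_lt.1 hj)]
  rw [norm_smul, norm_smul, Real.norm_eq_abs, Real.norm_eq_abs, hm,
    abs_of_nonneg (by positivity), ← mul_assoc] at this
  exact this

theorem kconst_good {d : ℕ} {ε : ℝ} {f : Euc d → ℂ} (k : Fin d)
    (hf : ContDiff ℝ (d + 2) f)
    (h : ∀ (α β : Fin d → Bool) (j : Fin d),
      LinfNorm ε (fun x => monom β x • pdMulti α f x) < ⊤
      ∧ LinfNorm ε (fun x => monom β x • pd j (pdMulti α f) x) < ⊤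
      ∧ LinfNorm ε (fun x => (x j * monom β x) • pdMulti α f x) < ⊤) :
    Kconst ε f ≠ ⊤ ∧ Good ε (Kconst ε f).toReal ((List.finRange d).reverse ++ [k]) f := by
  have hfin : Kconst ε f ≠ ⊤ := by
    unfold Kconst
    rw [← lt_top_iff_ne_top]
    have fin_sup : ∀ {ι : Type} [Finite ι] (u : ι → ℝ≥0∞), (∀ i, u i < ⊤) → ⨆ i, u i < ⊤ := by
      intro ι _ u hu
      rcases isEmpty_or_nonempty ι with hι | hι
      · simp
      · obtain ⟨i, hi⟩ := exists_eq_ciSup_of_finite (f := u)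
        rw [← hi]; exact hu i
    refine fin_sup _ fun α => fin_sup _ fun β => fin_sup _ fun j => ?_
    exact max_lt (max_lt (h α β j).1 (h α β j).2.1) (h α β j).2.2
  refine ⟨hfin, good_of_sublists _ _ (hf.of_le ?_) ?_⟩
  · simp only [List.length_append, List.length_reverse, List.length_finRange, List.length_singleton]
    norm_cast; omega
  intro S hS
  obtain ⟨S1, S2, rfl, hS1, hS2⟩ := List.sublist_append_iff.1 hS
  have hS1' : S1.reverse.Sublist (List.finRange d) := by
    have := hS1.reverse
    simpa using this
  have e := sublist_eq_filter hS1' (List.nodup_finRange d)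
  have e2 : S1.foldl (fun f j => pd j f) f = pdMulti (fun j => decide (j ∈ S1.reverse)) f := by
    unfold pdMulti
    rw [e, List.foldr_reverse]
  have hle : ∀ α β : Fin d → Bool, ∀ j : Fin d,
      LinfNorm ε (fun x => monom β x • pdMulti α f x)
      ⊔ LinfNorm ε (fun x => monom β x • pd j (pdMulti α f) x)
      ⊔ LinfNorm ε (fun x => (x j * monom β x) • pdMulti α f x) ≤ Kconst ε f := by
    intro α β j
    unfold Kconst
    exact le_iSup_of_le α (le_iSup_of_le β (le_iSup_of_le j le_rfl))
  rw [List.foldl_append, e2]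
  apply bnd_of_linf hfin
  intro β
  have hS2' : S2 = [] ∨ S2 = [k] := by
    rcases S2 with _ | ⟨a, S2⟩
    · simp
    · right
      exact List.sublist_singleton.1 hS2 |>.resolve_left (by simp)
  rcases hS2' with rfl | rfl
  · exact le_trans (le_sup_left.trans le_sup_left) (hle _ β k)
  · exact le_trans (le_sup_right.trans le_sup_left) (hle _ β k)

theorem const_le (d : ℕ) (hd : 1 ≤ d) : (2 * Real.pi) ^ d ≤ 2 ^ (2 * d + 1) * (d : ℝ) ^ d := by
  have h8 : (2 * Real.pi) ^ d ≤ (8 : ℝ) ^ d := by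
    have := Real.pi_le_four
    have := Real.pi_pos
    gcongr
    linarith
  refine h8.trans ?_
  rcases Nat.lt_or_ge d 2 with h | h
  · obtain rfl : d = 1 := by omega
    norm_num
  · have h2 : (2 : ℝ) ^ d ≤ (d : ℝ) ^ d := by
      gcongr
      exact_mod_cast h
    have : (8 : ℝ) ^ d = 2 ^ (2 * d) * 2 ^ d := by
      rw [← pow_add, show 2 * d + d = 3 * d by ring, pow_mul]; norm_num
    rw [this]
    have h4 : (2 : ℝ) ^ (2 * d) ≤ 2 ^ (2 * d + 1) := by
      gcongr <;> norm_num
    gcongr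

/-- decay of the short-time Fourier transform for windows satisfying
weighted `L^∞_ε` bounds on their derivatives up to order `d+2`. -/
theorem stmt15 {d : ℕ} (ε : ℝ) (hε : 0 < ε) (γ g : Euc d → ℂ)
    (hγ_smooth : ContDiff ℝ (d + 2) γ) (hg_smooth : ContDiff ℝ (d + 2) g)
    (hγ : ∀ (α β : Fin d → Bool) (j : Fin d),
      LinfNorm ε (fun x => monom β x • pdMulti α γ x) < ⊤
      ∧ LinfNorm ε (fun x => monom β x • pd j (pdMulti α γ) x) < ⊤
      ∧ LinfNorm ε (fun x => (x j * monom β x) • pdMulti α γ x) < ⊤)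
    (hg : ∀ (α β : Fin d → Bool) (j : Fin d),
      LinfNorm ε (fun x => monom β x • pdMulti α g x) < ⊤
      ∧ LinfNorm ε (fun x => monom β x • pd j (pdMulti α g) x) < ⊤
      ∧ LinfNorm ε (fun x => (x j * monom β x) • pdMulti α g x) < ⊤) :
    ∀ (x ω : Euc d) (k : Fin d),
      ENNReal.ofReal ((1 + ‖x‖) ^ ((d : ℝ) + ε) * (1 + |ω k|) ^ 2
          * (∏ j ∈ Finset.univ.erase k, (1 + |ω j|)) * ‖STFT g γ x ω‖)
        ≤ 2 ^ (2 * d + 1) * (d : ℝ≥0∞) ^ d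
            * ENNReal.ofReal ((1 + 1 / Real.pi) ^ (d + 1))
            * Kconst ε γ * Kconst ε g := by
  intro x ω k
  obtain ⟨hKγ, gγ⟩ := kconst_good k hγ_smooth hγ
  obtain ⟨hKg, gg⟩ := kconst_good k hg_smooth hg
  have hmain := main_ind hε ENNReal.toReal_nonneg x ω _ γ g gγ gg
  set A := (Kconst ε γ).toReal with hA
  set B := (Kconst ε g).toReal with hB
  have hA0 : 0 ≤ A := ENNReal.toReal_nonneg
  have hB0 : 0 ≤ B := ENNReal.toReal_nonneg
  have hprod : (((List.finRange d).reverse ++ [k]).map fun j => 1 + |ω j|).prod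
      = (1 + |ω k|) ^ 2 * ∏ j ∈ Finset.univ.erase k, (1 + |ω j|) := by
    rw [List.map_append, List.prod_append, List.map_reverse, List.prod_reverse,
      ← List.ofFn_eq_map, List.prod_ofFn, ← Finset.mul_prod_erase _ _ (Finset.mem_univ k)]
    simp
    ring
  have hlen : ((List.finRange d).reverse ++ [k]).length = d + 1 := by simp
  rw [hprod, hlen] at hmain
  have hw : 0 < (1 + ‖x‖) ^ ((d : ℝ) + ε) := by positivity
  have hpi := Real.pi_pos
  have hc := const_le d (by have := k.2; omega)
  have hreal : (1 + ‖x‖) ^ ((d : ℝ) + ε) * (1 + |ω k|) ^ 2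
          * (∏ j ∈ Finset.univ.erase k, (1 + |ω j|)) * ‖STFT g γ x ω‖
      ≤ 2 ^ (2 * d + 1) * (d : ℝ) ^ d * (1 + 1 / Real.pi) ^ (d + 1) * A * B := by
    calc _ = (1 + ‖x‖) ^ ((d : ℝ) + ε) * ((1 + |ω k|) ^ 2
          * (∏ j ∈ Finset.univ.erase k, (1 + |ω j|)) * ‖STFT g γ x ω‖) := by ring
      _ ≤ (1 + ‖x‖) ^ ((d : ℝ) + ε) * ((1 + 1 / Real.pi) ^ (d + 1) *
          (((1 + ‖x‖) ^ ((d : ℝ) + ε))⁻¹ * (A * B * (2 * Real.pi) ^ d))) := by gcongr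
      _ = (2 * Real.pi) ^ d * (1 + 1 / Real.pi) ^ (d + 1) * A * B := by
        field_simp
      _ ≤ 2 ^ (2 * d + 1) * (d : ℝ) ^ d * (1 + 1 / Real.pi) ^ (d + 1) * A * B := by
        have hq : 0 ≤ (1 + 1 / Real.pi) ^ (d + 1) := by positivity
        exact mul_le_mul_of_nonneg_right (mul_le_mul_of_nonneg_right
          (mul_le_mul_of_nonneg_right hc hq) hA0) hB0
  refine (ENNReal.ofReal_le_ofReal hreal).trans (le_of_eq ?_)
  rw [ENNReal.ofReal_mul (by positivity), ENNReal.ofReal_mul (by positivity),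
    ENNReal.ofReal_mul (by positivity), ENNReal.ofReal_mul (by positivity),
    hA, hB, ENNReal.ofReal_toReal hKγ, ENNReal.ofReal_toReal hKg,
    ENNReal.ofReal_pow (by positivity) d, ENNReal.ofReal_natCast,
    ENNReal.ofReal_pow (by positivity) (2 * d + 1), ENNReal.ofReal_ofNat]
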